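/- In êP'(ℂ) the element κ := [x,1,1] + [x,0,0] - [x,1,0] - [x,0,1] is independent of the choice of x and has order exactly 2. Moreover êP'(ℂ) ≅ êP(ℂ) × C₂ and êB'(ℂ) ≅ êB(ℂ) × C₂, where C₂ is the cyclic group of order 2 generated by κ, êP(ℂ) is the further quotient of êP'(ℂ) by the transfer relations, and êB'(ℂ), êB(ℂ) are the kernels of ν on êP'(ℂ) and êP(ℂ) respectively. -/

import Mathlib

open Complex
open scoped Classical

noncomputable section

namespace ExtendedBloch

/-- `π` as a complex number. -/
def Cpi : ℂ := (Real.pi : ℂ)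

/-- Membership in `ℂ ∖ {0,1}`. -/
def Reg (z : ℂ) : Prop := z ≠ 0 ∧ z ≠ 1

/-- The open upper half plane. -/
def UHP : Set ℂ := {z : ℂ | 0 < z.im}

/-- The 5-tuple occurring in the five term relation. -/
def ftTuple (x y : ℂ) : Fin 5 → ℂ :=
  ![x, y, y / x, (1 - x⁻¹) / (1 - y⁻¹), (1 - x) / (1 - y)]

/-- The set `FT` of five term tuples. -/
def FT : Set (Fin 5 → ℂ) :=
  {v | ∃ x y : ℂ, Reg x ∧ Reg y ∧ x ≠ y ∧ v = ftTuple x y}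

/-- The subset `FT⁺` of tuples with all coordinates in the upper half plane. -/
def FTplus : Set (Fin 5 → ℂ) := {v | v ∈ FT ∧ ∀ i, v i ∈ UHP}

/-- The point `(z; p, q)` of the cover `𝓒` of `ℂ ∖ {0,1}`, realized concretely as the pair of
branch values `(log z + pπi, -log(1-z) + qπi)` (Riemann surface model of `𝓒`). -/
def pt (z : ℂ) (p q : ℤ) : ℂ × ℂ :=
  (Complex.log z + p * (Cpi * I), -Complex.log (1 - z) + q * (Cpi * I))

/-- The cover `𝓒`, realized as the Riemann surface of all branches of
`(log z + pπi, -log(1-z) + qπi)` on `ℂ ∖ {0,1}`. -/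
def Cover : Set (ℂ × ℂ) := {w | ∃ z : ℂ, Reg z ∧ ∃ p q : ℤ, w = pt z p q}

lemma pt_mem_Cover {z : ℂ} (h : Reg z) (p q : ℤ) : pt z p q ∈ Cover :=
  ⟨z, h, p, q, rfl⟩

/-- `w ∈ 𝓒` lies over `z ∈ ℂ ∖ {0,1}`. -/
def LiesOver (w : ℂ × ℂ) (z : ℂ) : Prop := Reg z ∧ ∃ p q : ℤ, w = pt z p q

/-- The covering action of `ℤ × ℤ` on `𝓒`. -/
def covAct (v : ℤ × ℤ) (w : ℂ × ℂ) : ℂ × ℂ :=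
  (w.1 + v.1 * (Cpi * I), w.2 + v.2 * (Cpi * I))

/-- The subset `V ⊂ (ℤ × ℤ)⁵`. -/
def Vset : Set (Fin 5 → ℤ × ℤ) :=
  {v | ∃ p₀ p₁ q₀ q₁ q₂ : ℤ,
    v = ![(p₀, q₀), (p₁, q₁), (p₁ - p₀, q₂), (p₁ - p₀ + q₁ - q₀, q₂ - q₁),
          (q₁ - q₀, q₂ - q₁ - p₀)]}

/-- The preimage of `FT` in `𝓒⁵`. -/
def FTpre : Set (Fin 5 → ℂ × ℂ) := {w | ∃ v ∈ FT, ∀ i, LiesOver (w i) (v i)}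

/-- A base point `((x₀;0,0),…,(x₄;0,0))` with `(x₀,…,x₄) ∈ FT⁺`. -/
def basePt : Fin 5 → ℂ × ℂ := fun i => pt (ftTuple ((1 + I) / 4) I i) 0 0

/-- `𝓕𝓣̂₀`: the connected component of the preimage of `FT` in `𝓒⁵` containing the points
`((x₀;0,0),…,(x₄;0,0))` with `(x₀,…,x₄) ∈ FT⁺`. -/
def FThat₀ : Set (Fin 5 → ℂ × ℂ) := connectedComponentIn FTpre basePt

/-- `𝓕𝓣̂ = 𝓕𝓣̂₀ + V`. -/
def FThat : Set (Fin 5 → ℂ × ℂ) :=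
  {u | ∃ w ∈ FThat₀, ∃ v ∈ Vset, u = fun i => covAct (v i) (w i)}

abbrev CoverT : Type := ↥Cover

/-- The generator `(z; p, q)` of the free abelian group on `𝓒`. -/
def genOf (z : ℂ) (h : Reg z) (p q : ℤ) : FreeAbelianGroup CoverT :=
  FreeAbelianGroup.of ⟨pt z p q, pt_mem_Cover h p q⟩

/-- The lifted five term relators. -/
def FiveTermRels : Set (FreeAbelianGroup CoverT) :=
  {a | ∃ w : Fin 5 → ℂ × ℂ, w ∈ FThat ∧ ∃ hc : ∀ i, w i ∈ Cover,
    a = ∑ i : Fin 5, (-1 : ℤ) ^ (i : ℕ) • FreeAbelianGroup.of (⟨w i, hc i⟩ : CoverT)}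

/-- The transfer relators. -/
def TransferRels : Set (FreeAbelianGroup CoverT) :=
  {a | ∃ z : ℂ, ∃ h : Reg z, ∃ p q p' q' : ℤ,
    a = genOf z h p q + genOf z h p' q' - genOf z h p q' - genOf z h p' q}

def relSub : AddSubgroup (FreeAbelianGroup CoverT) :=
  AddSubgroup.closure (FiveTermRels ∪ TransferRels)

def relSub' : AddSubgroup (FreeAbelianGroup CoverT) :=
  AddSubgroup.closure FiveTermRels

/-- The extended pre-Bloch group `êP(ℂ)`. -/
abbrev EPreBloch : Type := FreeAbelianGroup CoverT ⧸ relSub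

/-- The variant `êP'(ℂ)` without the transfer relations. -/
abbrev EPreBloch' : Type := FreeAbelianGroup CoverT ⧸ relSub'

/-- The class `[z, p, q] ∈ êP(ℂ)` (junk value `0` if `z ∈ {0,1}`). -/
def cls (z : ℂ) (p q : ℤ) : EPreBloch :=
  if h : Reg z then QuotientAddGroup.mk (genOf z h p q) else 0

/-- The class `[z, p, q] ∈ êP'(ℂ)` (junk value `0` if `z ∈ {0,1}`). -/
def cls' (z : ℂ) (p q : ℤ) : EPreBloch' :=
  if h : Reg z then QuotientAddGroup.mk (genOf z h p q) else 0

/-- `ℂ ∧_ℤ ℂ`, the second exterior power of `ℂ` as a `ℤ`-module. -/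
abbrev L2C : Type := ↥(⋀[ℤ]^2 ℂ)

/-- The wedge `a ∧ b ∈ ℂ ∧_ℤ ℂ`. -/
def wedge (a b : ℂ) : L2C :=
  ⟨ExteriorAlgebra.ιMulti ℤ 2 ![a, b],
   ExteriorAlgebra.ιMulti_range ℤ 2 (Set.mem_range_self _)⟩

def nuFree : FreeAbelianGroup CoverT →+ L2C :=
  FreeAbelianGroup.lift fun w : CoverT => wedge w.1.1 w.1.2

/-- The homomorphism `ν : êP(ℂ) → ℂ ∧_ℤ ℂ`. -/
def nuHom : EPreBloch →+ L2C :=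
  if h : ∀ a ∈ relSub, nuFree a = 0 then QuotientAddGroup.lift relSub nuFree h else 0

/-- The homomorphism `ν : êP'(ℂ) → ℂ ∧_ℤ ℂ`. -/
def nuHom' : EPreBloch' →+ L2C :=
  if h : ∀ a ∈ relSub', nuFree a = 0 then QuotientAddGroup.lift relSub' nuFree h else 0

/-- The extended Bloch group `êB(ℂ) = ker ν`. -/
def EBloch : AddSubgroup EPreBloch := nuHom.ker

/-- `êB'(ℂ) = ker ν` on `êP'(ℂ)`. -/
def EBloch' : AddSubgroup EPreBloch' := nuHom'.ker

/-- The component `X₀₀` of `𝓒` (both fiber coordinates even). -/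
def X00 : Set (ℂ × ℂ) := {w | ∃ z : ℂ, Reg z ∧ ∃ p q : ℤ, w = pt z (2 * p) (2 * q)}

abbrev X00T : Type := ↥X00

lemma pt_mem_X00 {z : ℂ} (h : Reg z) (p q : ℤ) : pt z (2 * p) (2 * q) ∈ X00 :=
  ⟨z, h, p, q, rfl⟩

/-- The generator `(z; 2p, 2q)` of the free abelian group on `X₀₀`. -/
def genOf₀ (z : ℂ) (h : Reg z) (p q : ℤ) : FreeAbelianGroup X00T :=
  FreeAbelianGroup.of ⟨pt z (2 * p) (2 * q), pt_mem_X00 h p q⟩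

/-- The five term relators coming from `𝓕𝓣̂ ∩ (X₀₀)⁵`. -/
def FiveTermRels₀ : Set (FreeAbelianGroup X00T) :=
  {a | ∃ w : Fin 5 → ℂ × ℂ, w ∈ FThat ∧ ∃ hc : ∀ i, w i ∈ X00,
    a = ∑ i : Fin 5, (-1 : ℤ) ^ (i : ℕ) • FreeAbelianGroup.of (⟨w i, hc i⟩ : X00T)}

def relSub₀ : AddSubgroup (FreeAbelianGroup X00T) := AddSubgroup.closure FiveTermRels₀

/-- The true extended pre-Bloch group `êêP(ℂ)`. -/
abbrev EEPreBloch : Type := FreeAbelianGroup X00T ⧸ relSub₀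

/-- The class `[z, 2p, 2q] ∈ êêP(ℂ)` (junk value `0` if `z ∈ {0,1}`). -/
def cls₀ (z : ℂ) (p q : ℤ) : EEPreBloch :=
  if h : Reg z then QuotientAddGroup.mk (genOf₀ z h p q) else 0

def nuFree₀ : FreeAbelianGroup X00T →+ L2C :=
  FreeAbelianGroup.lift fun w : X00T => wedge w.1.1 w.1.2

/-- The homomorphism `ν̂ : êêP(ℂ) → ℂ ∧_ℤ ℂ`. -/
def nuHom₀ : EEPreBloch →+ L2C :=
  if h : ∀ a ∈ relSub₀, nuFree₀ a = 0 then QuotientAddGroup.lift relSub₀ nuFree₀ h else 0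

/-- The true extended Bloch group `êêB(ℂ) = ker ν̂`. -/
def EEBloch : AddSubgroup EEPreBloch := nuHom₀.ker

/-- The Rogers dilogarithm `𝓡(z) = ½ log z log(1-z) - ∫₀ᶻ log(1-t)/t dt` (straight segment,
parametrized by `t = s z`). -/
def rogers (z : ℂ) : ℂ :=
  (1 / 2) * Complex.log z * Complex.log (1 - z) -
    ∫ s in (0:ℝ)..(1:ℝ), Complex.log (1 - (s : ℂ) * z) / (s : ℂ)

/-- `R(z; p, q) = 𝓡(z) + (πi/2)(p log(1-z) + q log z) - π²/6`. -/
def Rfun (z : ℂ) (p q : ℤ) : ℂ :=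
  rogers z + (Cpi * I / 2) * (p * Complex.log (1 - z) + q * Complex.log z) - Cpi ^ 2 / 6

/-- `R̂(z; 2p, 2q) = 𝓡(z) + πi(p log(1-z) + q log z) - π²/6`. -/
def Rhat (z : ℂ) (p q : ℤ) : ℂ :=
  rogers z + Cpi * I * (p * Complex.log (1 - z) + q * Complex.log z) - Cpi ^ 2 / 6

/-- `ℂ / π²ℤ`. -/
abbrev ModPiSq : Type := ℂ ⧸ AddSubgroup.zmultiples (Cpi ^ 2)

/-- `ℂ / 2π²ℤ`. -/
abbrev Mod2PiSq : Type := ℂ ⧸ AddSubgroup.zmultiples (2 * Cpi ^ 2)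

abbrev RegT : Type := {z : ℂ // Reg z}

def pbGen (z : ℂ) (h : Reg z) : FreeAbelianGroup RegT := FreeAbelianGroup.of ⟨z, h⟩

/-- The five term relators for the classical pre-Bloch group. -/
def pbRels : Set (FreeAbelianGroup RegT) :=
  {a | ∃ x y : ℂ, ∃ hx : Reg x, ∃ hy : Reg y, x ≠ y ∧
    ∃ h2 : Reg (y / x), ∃ h3 : Reg ((1 - x⁻¹) / (1 - y⁻¹)), ∃ h4 : Reg ((1 - x) / (1 - y)),
    a = pbGen x hx - pbGen y hy + pbGen (y / x) h2 -
        pbGen ((1 - x⁻¹) / (1 - y⁻¹)) h3 + pbGen ((1 - x) / (1 - y)) h4}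

def pbSub : AddSubgroup (FreeAbelianGroup RegT) := AddSubgroup.closure pbRels

/-- The classical pre-Bloch group `P(ℂ)`. -/
abbrev PreBloch : Type := FreeAbelianGroup RegT ⧸ pbSub

/-- The class `[z] ∈ P(ℂ)` (junk value `0` if `z ∈ {0,1}`). -/
def pbCls (z : ℂ) : PreBloch :=
  if h : Reg z then QuotientAddGroup.mk (pbGen z h) else 0

/-- `ℂ* ∧_ℤ ℂ*`, the second exterior power of the multiplicative group `ℂ*` as `ℤ`-module. -/
abbrev L2CU : Type := ↥(⋀[ℤ]^2 (Additive ℂˣ))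

/-- The wedge `a ∧ b ∈ ℂ* ∧_ℤ ℂ*`. -/
def wedgeU (a b : ℂˣ) : L2CU :=
  ⟨ExteriorAlgebra.ιMulti ℤ 2 ![Additive.ofMul a, Additive.ofMul b],
   ExteriorAlgebra.ιMulti_range ℤ 2 (Set.mem_range_self _)⟩

def nuPBFree : FreeAbelianGroup RegT →+ L2CU :=
  FreeAbelianGroup.lift fun z : RegT =>
    2 • wedgeU (Units.mk0 z.1 z.2.1) (Units.mk0 (1 - z.1) (sub_ne_zero_of_ne (Ne.symm z.2.2)))

/-- The homomorphism `P(ℂ) → ℂ* ∧_ℤ ℂ*`, `[z] ↦ 2 (z ∧ (1-z))`. -/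
def nuPB : PreBloch →+ L2CU :=
  if h : ∀ a ∈ pbSub, nuPBFree a = 0 then QuotientAddGroup.lift pbSub nuPBFree h else 0

/-- The classical Bloch group `B(ℂ)`. -/
def Bloch : AddSubgroup PreBloch := nuPB.ker

/-- The roots of unity in `ℂ*`. -/
def muStar : Set ℂˣ := {ζ | ∃ n : ℕ, 0 < n ∧ ζ ^ n = 1}

abbrev SL2C := Matrix.SpecialLinearGroup (Fin 2) ℂ

/-- `PSL(2,ℂ) = SL(2,ℂ)/{±1}` as a discrete group. -/
abbrev PSL2C := SL2C ⧸ Subgroup.center SL2C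

/-- The boundary map `C₃ → C₂` of the inhomogeneous bar complex computing `H₃(PSL(2,ℂ);ℤ)`. -/
def d3 : FreeAbelianGroup (Fin 3 → PSL2C) →+ FreeAbelianGroup (Fin 2 → PSL2C) :=
  FreeAbelianGroup.lift fun g =>
    FreeAbelianGroup.of ![g 1, g 2] - FreeAbelianGroup.of ![g 0 * g 1, g 2] +
      FreeAbelianGroup.of ![g 0, g 1 * g 2] - FreeAbelianGroup.of ![g 0, g 1]

/-- The boundary map `C₄ → C₃` of the inhomogeneous bar complex computing `H₃(PSL(2,ℂ);ℤ)`. -/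
def d4 : FreeAbelianGroup (Fin 4 → PSL2C) →+ FreeAbelianGroup (Fin 3 → PSL2C) :=
  FreeAbelianGroup.lift fun g =>
    FreeAbelianGroup.of ![g 1, g 2, g 3] - FreeAbelianGroup.of ![g 0 * g 1, g 2, g 3] +
      FreeAbelianGroup.of ![g 0, g 1 * g 2, g 3] - FreeAbelianGroup.of ![g 0, g 1, g 2 * g 3] +
      FreeAbelianGroup.of ![g 0, g 1, g 2]

/-- `H₃(PSL(2,ℂ);ℤ)`, defined as homology of the inhomogeneous bar complex. -/
abbrev H3PSL2C : Type := ↥d3.ker ⧸ ((d4.range).addSubgroupOf d3.ker)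

/-- The set of combinatorial flattenings. -/
def Flattenings : Set (ℂ × ℂ × ℂ) :=
  {w | w.1 + w.2.1 + w.2.2 = 0 ∧ ∃ z : ℂ, Reg z ∧ ∃ p q r : ℤ,
    w.1 = Complex.log z + p * (Cpi * I) ∧
    w.2.1 = -Complex.log (1 - z) + q * (Cpi * I) ∧
    w.2.2 = Complex.log (1 - z) - Complex.log z + r * (Cpi * I)}

/-- The map `ℓ : 𝓒 → ℂ³`. -/
def ellMap (w : ℂ × ℂ) : ℂ × ℂ × ℂ := (w.1, w.2, -w.1 - w.2)

/-- The element `κ = [x,1,1] + [x,0,0] - [x,1,0] - [x,0,1] ∈ êP'(ℂ)`. -/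
def kap (x : ℂ) : EPreBloch' := cls' x 1 1 + cls' x 0 0 - cls' x 1 0 - cls' x 0 1

/-- The natural projection `êP'(ℂ) → êP(ℂ)`. -/
def projP : EPreBloch' →+ EPreBloch :=
  QuotientAddGroup.map relSub' relSub (AddMonoidHom.id _)
    (by
      rw [AddSubgroup.comap_id]
      exact AddSubgroup.closure_mono Set.subset_union_left)

/-! ### Lifting paths to the cover -/

/-- Pairs `(x, y)` that parametrize `FT`. -/
def Admissible (x y : ℂ) : Prop := Reg x ∧ Reg y ∧ x ≠ y

lemma Reg.one_sub_ne_zero {z : ℂ} (h : Reg z) : 1 - z ≠ 0 := sub_ne_zero_of_ne h.2.symm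

lemma Admissible.reg_ftTuple {x y : ℂ} (h : Admissible x y) (i : Fin 5) :
    Reg (ftTuple x y i) := by
  obtain ⟨hx, hy, hxy⟩ := h
  have hx0 := hx.1
  have hy0 := hy.1
  have hx1 := hx.one_sub_ne_zero
  have hy1 := hy.one_sub_ne_zero
  have hyi : 1 - y⁻¹ ≠ 0 := by
    intro h
    apply hy.2
    field_simp at h
    linear_combination h
  have hxi : 1 - x⁻¹ ≠ 0 := by
    intro h
    apply hx.2
    field_simp at h
    linear_combination h
  fin_cases i
  · exact hx
  · exact hy
  · refine ⟨div_ne_zero hy0 hx0, fun h => hxy ?_⟩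
    exact ((div_eq_one_iff_eq hx0).1 h).symm
  · refine ⟨div_ne_zero hxi hyi, fun h => hxy ?_⟩
    exact inv_injective (sub_right_injective ((div_eq_one_iff_eq hyi).1 h))
  · refine ⟨div_ne_zero hx1 hy1, fun h => hxy ?_⟩
    exact sub_right_injective ((div_eq_one_iff_eq hy1).1 h)

lemma continuous_ftTuple {x y : C(unitInterval, ℂ)} (h : ∀ t, Admissible (x t) (y t))
    (i : Fin 5) : Continuous fun t => ftTuple (x t) (y t) i := by
  have hx0 : ∀ t, x t ≠ 0 := fun t => (h t).1.1
  have hy0 : ∀ t, y t ≠ 0 := fun t => (h t).2.1.1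
  have hy1 : ∀ t, 1 - y t ≠ 0 := fun t => (h t).2.1.one_sub_ne_zero
  have hyi : ∀ t, 1 - (y t)⁻¹ ≠ 0 := by
    intro t h'
    apply (h t).2.1.2
    have := hy0 t
    field_simp at h'
    linear_combination h'
  fin_cases i
  · exact x.continuous
  · exact y.continuous
  · exact y.continuous.div x.continuous hx0
  · exact (continuous_const.sub (x.continuous.inv₀ hx0)).div
      (continuous_const.sub (y.continuous.inv₀ hy0)) hyi
  · exact (continuous_const.sub x.continuous).div (continuous_const.sub y.continuous) hy1

lemma exists_continuous_log (γ : C(unitInterval, ℂ)) (h : ∀ t, γ t ≠ 0) :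
    ∃ F : C(unitInterval, ℂ), F 0 = Complex.log (γ 0) ∧ ∀ t, Complex.exp (F t) = γ t := by
  obtain ⟨F, hF, h0⟩ := Complex.isCoveringMap_exp.exists_path_lifts
    ⟨fun t => ⟨γ t, h t⟩, by fun_prop⟩ (Complex.log (γ 0))
    (Subtype.ext (Complex.exp_log (h 0)).symm)
  exact ⟨F, h0, fun t => congrArg Subtype.val (congrFun hF t)⟩

lemma exists_eq_log_add {w z : ℂ} (hz : z ≠ 0) (h : Complex.exp w = z) :
    ∃ n : ℤ, w = Complex.log z + (2 * n : ℤ) * (Cpi * I) := by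
  rw [← Complex.exp_log hz, Complex.exp_eq_exp_iff_exists_int] at h
  obtain ⟨n, hn⟩ := h
  refine ⟨n, ?_⟩
  rw [hn, Cpi]
  push_cast
  ring

lemma exists_lift_cover (γ : C(unitInterval, ℂ)) (h : ∀ t, Reg (γ t)) {w : ℂ × ℂ}
    (hw : LiesOver w (γ 0)) :
    ∃ Γ : C(unitInterval, ℂ × ℂ), Γ 0 = w ∧ ∀ t, LiesOver (Γ t) (γ t) := by
  obtain ⟨-, p, q, rfl⟩ := hw
  obtain ⟨F, F0, hF⟩ := exists_continuous_log γ fun t => (h t).1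
  obtain ⟨G, G0, hG⟩ := exists_continuous_log ⟨fun t => 1 - γ t, by fun_prop⟩
    fun t => (h t).one_sub_ne_zero
  refine ⟨⟨fun t => (F t + p * (Cpi * I), -G t + q * (Cpi * I)), by fun_prop⟩, ?_, ?_⟩
  · simp [F0, G0, pt]
  · intro t
    obtain ⟨m, hm⟩ := exists_eq_log_add (h t).1 (hF t)
    obtain ⟨n, hn⟩ := exists_eq_log_add (h t).one_sub_ne_zero (hG t)
    refine ⟨h t, p + 2 * m, q - 2 * n, ?_⟩
    simp only [ContinuousMap.coe_mk, pt, hm, hn]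
    push_cast
    ext <;> ring

/-! ### The component `𝓕𝓣̂₀` surjects onto `FT` -/

/-- Some point of `𝓕𝓣̂₀` lies over the tuple of `(x, y)`. -/
def HasLift (x y : ℂ) : Prop := ∃ w ∈ FThat₀, ∀ i, LiesOver (w i) (ftTuple x y i)

lemma admissible_base : Admissible ((1 + I) / 4) I := by
  refine ⟨⟨?_, ?_⟩, ⟨?_, ?_⟩, ?_⟩ <;> intro h <;>
    have h' := congrArg Complex.im h <;> norm_num at h'

lemma basePt_mem_FTpre : basePt ∈ FTpre :=
  ⟨_, ⟨_, _, admissible_base.1, admissible_base.2.1, admissible_base.2.2, rfl⟩,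
    fun i => ⟨admissible_base.reg_ftTuple i, 0, 0, rfl⟩⟩

lemma hasLift_base : HasLift ((1 + I) / 4) I :=
  ⟨basePt, mem_connectedComponentIn basePt_mem_FTpre,
    fun i => ⟨admissible_base.reg_ftTuple i, 0, 0, rfl⟩⟩

lemma HasLift.of_path {x y : C(unitInterval, ℂ)} (h : ∀ t, Admissible (x t) (y t))
    (h0 : HasLift (x 0) (y 0)) : HasLift (x 1) (y 1) := by
  obtain ⟨w, hw, hwl⟩ := h0
  choose Γ hΓ0 hΓ using fun i => exists_lift_cover ⟨_, continuous_ftTuple h i⟩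
    (fun t => (h t).reg_ftTuple i) (hwl i)
  have hc : Continuous fun t => fun i => Γ i t := by fun_prop
  have hw' : FThat₀ = connectedComponentIn FTpre w := connectedComponentIn_eq hw
  refine ⟨fun i => Γ i 1, ?_, fun i => hΓ i 1⟩
  rw [hw']
  refine (isPreconnected_range hc).subset_connectedComponentIn ⟨0, funext hΓ0⟩ ?_
    (Set.mem_range_self 1)
  rintro _ ⟨t, rfl⟩
  exact ⟨_, ⟨x t, y t, (h t).1, (h t).2.1, (h t).2.2, rfl⟩, fun i => hΓ i t⟩

lemma exists_path_avoiding {a b c : ℂ} (ha : Reg a ∧ a ≠ c) (hb : Reg b ∧ b ≠ c) :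
    ∃ γ : C(unitInterval, ℂ), γ 0 = a ∧ γ 1 = b ∧ ∀ t, Reg (γ t) ∧ γ t ≠ c := by
  have hr : 1 < Module.rank ℝ ℂ := by rw [Complex.rank_real_complex]; norm_num
  have hs : ({0, 1, c} : Set ℂ).Countable := Set.Finite.countable (by simp)
  have hmem : ∀ z : ℂ, z ∈ ({0, 1, c} : Set ℂ)ᶜ ↔ Reg z ∧ z ≠ c := by
    intro z
    simp [Reg, and_assoc]
  obtain ⟨γ, hγ⟩ := (hs.isPathConnected_compl_of_one_lt_rank hr).joinedIn a ((hmem a).2 ha) b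
    ((hmem b).2 hb)
  exact ⟨γ, γ.source, γ.target, fun t => (hmem _).1 (hγ t)⟩

lemma HasLift.move_left {x x' y : ℂ} (h : Admissible x y) (h' : Admissible x' y)
    (hl : HasLift x y) : HasLift x' y := by
  obtain ⟨γ, rfl, rfl, hγ⟩ := exists_path_avoiding ⟨h.1, h.2.2⟩ ⟨h'.1, h'.2.2⟩
  exact HasLift.of_path (x := γ) (y := ContinuousMap.const _ y)
    (fun t => ⟨(hγ t).1, h.2.1, (hγ t).2⟩) hl

lemma HasLift.move_right {x y y' : ℂ} (h : Admissible x y) (h' : Admissible x y')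
    (hl : HasLift x y) : HasLift x y' := by
  obtain ⟨γ, rfl, rfl, hγ⟩ := exists_path_avoiding ⟨h.2.1, h.2.2.symm⟩ ⟨h'.2.1, h'.2.2.symm⟩
  exact HasLift.of_path (x := ContinuousMap.const _ x) (y := γ)
    (fun t => ⟨h.1, (hγ t).1, (hγ t).2.symm⟩) hl

lemma Admissible.hasLift {x y : ℂ} (h : Admissible x y) : HasLift x y := by
  obtain ⟨c, hc⟩ := Infinite.exists_notMem_finset ({0, 1, (1 + I) / 4, x} : Finset ℂ)
  simp only [Finset.mem_insert, Finset.mem_singleton, not_or] at hc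
  obtain ⟨hc0, hc1, hcb, hcx⟩ := hc
  have h1 : Admissible ((1 + I) / 4) c := ⟨admissible_base.1, ⟨hc0, hc1⟩, Ne.symm hcb⟩
  have h2 : Admissible x c := ⟨h.1, ⟨hc0, hc1⟩, Ne.symm hcx⟩
  exact ((hasLift_base.move_right admissible_base h1).move_left h1 h2).move_right h2 h

/-! ### Five term relations over an arbitrary point of `FT` -/

lemma covAct_pt (v : ℤ × ℤ) (z : ℂ) (p q : ℤ) :
    covAct v (pt z p q) = pt z (p + v.1) (q + v.2) := by
  simp only [covAct, pt]
  push_cast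
  ext <;> ring

lemma cls'_eq {z : ℂ} (h : Reg z) (p q : ℤ) :
    cls' z p q = QuotientAddGroup.mk (genOf z h p q) := dif_pos h

/-- The relations obtained from a single lift by acting with `V`. -/
lemma exists_five_term {x y : ℂ} (h : Admissible x y) :
    ∃ P Q : Fin 5 → ℤ, ∀ p₀ p₁ q₀ q₁ q₂ : ℤ,
      cls' (ftTuple x y 0) (P 0 + p₀) (Q 0 + q₀) - cls' (ftTuple x y 1) (P 1 + p₁) (Q 1 + q₁) +
        cls' (ftTuple x y 2) (P 2 + (p₁ - p₀)) (Q 2 + q₂) -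
        cls' (ftTuple x y 3) (P 3 + (p₁ - p₀ + q₁ - q₀)) (Q 3 + (q₂ - q₁)) +
        cls' (ftTuple x y 4) (P 4 + (q₁ - q₀)) (Q 4 + (q₂ - q₁ - p₀)) = 0 := by
  obtain ⟨w, hw, hwl⟩ := h.hasLift
  choose P Q hPQ using fun i => (hwl i).2
  refine ⟨P, Q, fun p₀ p₁ q₀ q₁ q₂ => ?_⟩
  set v : Fin 5 → ℤ × ℤ := ![(p₀, q₀), (p₁, q₁), (p₁ - p₀, q₂), (p₁ - p₀ + q₁ - q₀, q₂ - q₁),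
          (q₁ - q₀, q₂ - q₁ - p₀)] with hv
  have hmem : (∑ i : Fin 5, (-1 : ℤ) ^ (i : ℕ) • genOf (ftTuple x y i) (h.reg_ftTuple i)
      (P i + (v i).1) (Q i + (v i).2)) ∈ relSub' := by
    refine AddSubgroup.subset_closure ⟨fun i => pt (ftTuple x y i) (P i + (v i).1) (Q i + (v i).2),
      ⟨w, hw, v, ⟨p₀, p₁, q₀, q₁, q₂, hv⟩, ?_⟩, fun i => pt_mem_Cover (h.reg_ftTuple i) _ _, rfl⟩
    funext i
    rw [hPQ i, covAct_pt]
  have hz := (QuotientAddGroup.eq_zero_iff _).2 hmem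
  simp only [cls'_eq (h.reg_ftTuple _)]
  rw [← hz]
  simp only [Fin.sum_univ_five, hv, ← QuotientAddGroup.mk_add, ← QuotientAddGroup.mk_sub]
  congr 1

/-! ### Consequences of the five term relations -/

section DoubleDifference

variable {A : Type*} [AddCommGroup A]

/-- `g` is, up to terms depending on only one variable, the bilinear map `(p, q) ↦ pq • k`. -/
def HasDoubleDiff (g : ℤ → ℤ → A) (k : A) : Prop :=
  ∀ p q p' q' : ℤ, g p q + g p' q' - g p q' - g p' q = ((p - p') * (q - q')) • k

lemma sub_eq_zsmul_of_succ_sub {f : ℤ → A} {c : A} (h : ∀ n, f (n + 1) - f n = c) (m n : ℤ) :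
    f m - f n = (m - n) • c := by
  have key : ∀ d : ℤ, f (n + d) - f n = d • c := by
    intro d
    induction d using Int.induction_on with
    | zero => simp
    | succ i ih => rw [add_smul, one_smul, ← ih, ← h (n + i), ← add_assoc]; abel
    | pred i ih =>
      have := h (n + (-i - 1))
      rw [show n + (-(i : ℤ) - 1) + 1 = n + -i by ring] at this
      rw [sub_smul, one_smul, ← ih, ← this]; abel
  simpa using key (m - n)

lemma hasDoubleDiff_of_succ {g : ℤ → ℤ → A} {a : ℤ → A} {k : A}
    (hg : ∀ p q, g p (q + 1) - g p q = a p) (ha : ∀ p, a (p + 1) - a p = k) :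
    HasDoubleDiff g k := by
  intro p q p' q'
  have h1 := sub_eq_zsmul_of_succ_sub (hg p) q q'
  have h2 := sub_eq_zsmul_of_succ_sub (hg p') q q'
  have h3 := sub_eq_zsmul_of_succ_sub ha p p'
  rw [mul_comm, mul_smul, ← h3, smul_sub, ← h1, ← h2]
  abel

lemma HasDoubleDiff.of_shift {g : ℤ → ℤ → A} {k : A} {m n : ℤ}
    (h : HasDoubleDiff (fun p q => g (m + p) (n + q)) k) : HasDoubleDiff g k := by
  intro p q p' q'
  have := h (p - m) (q - n) (p' - m) (q' - n)
  simpa using this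

lemma HasDoubleDiff.shift {g : ℤ → ℤ → A} {k : A} (h : HasDoubleDiff g k) (m n : ℤ) :
    HasDoubleDiff (fun p q => g (m + p) (n + q)) k := by
  intro p q p' q'
  simpa using h (m + p) (n + q) (m + p') (n + q')

variable {g₀ g₁ g₂ g₃ g₄ : ℤ → ℤ → A}

lemma exists_hasDoubleDiff
    (H : ∀ p₀ p₁ q₀ q₁ q₂ : ℤ, g₀ p₀ q₀ - g₁ p₁ q₁ + g₂ (p₁ - p₀) q₂ -
      g₃ (p₁ - p₀ + q₁ - q₀) (q₂ - q₁) + g₄ (q₁ - q₀) (q₂ - q₁ - p₀) = 0) :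
    ∃ k, HasDoubleDiff g₂ k ∧ HasDoubleDiff g₃ k ∧ HasDoubleDiff g₄ k := by
  have D : ∀ p r s t q : ℤ, (g₂ p (q + 1) - g₂ p q) -
      (g₃ (p + r) (q - s + 1) - g₃ (p + r) (q - s)) +
      (g₄ r (q - t + 1) - g₄ r (q - t)) = 0 := by
    intro p r s t q
    have h1 := H (t - s) (p + t - s) (s - r) s (q + 1)
    have h2 := H (t - s) (p + t - s) (s - r) s q
    have e1 : p + t - s - (t - s) = p := by ring
    have e2 : p + s - (s - r) = p + r := by ring
    have e3 : s - (s - r) = r := by ring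
    have e4 : q + 1 - s - (t - s) = q - t + 1 := by ring
    have e5 : q - s - (t - s) = q - t := by ring
    have e6 : q + 1 - s = q - s + 1 := by ring
    rw [e1, e2, e3, e4, e6] at h1
    rw [e1, e2, e3, e5] at h2
    rw [← sub_eq_zero.2 (h1.trans h2.symm)]
    abel
  have D3 : ∀ p q, g₃ p (q + 1) - g₃ p q = g₃ p 1 - g₃ p 0 := by
    intro p q
    have h1 := D p 0 0 0 q
    have h2 := D p 0 q 0 q
    simp only [sub_zero, add_zero, sub_self, zero_add] at h1 h2
    rw [← sub_eq_zero, ← sub_eq_zero.2 (h2.trans h1.symm)]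
    abel
  have D4 : ∀ p q, g₄ p (q + 1) - g₄ p q = g₄ p 1 - g₄ p 0 := by
    intro p q
    have h1 := D 0 p 0 0 q
    have h2 := D 0 p 0 q q
    simp only [sub_zero, sub_self, zero_add] at h1 h2
    rw [← sub_eq_zero, ← sub_eq_zero.2 (h1.trans h2.symm)]
    abel
  have D2' : ∀ p r q, g₂ p (q + 1) - g₂ p q = (g₃ (p + r) 1 - g₃ (p + r) 0) -
      (g₄ r 1 - g₄ r 0) := by
    intro p r q
    rw [← D3 (p + r) q, ← D4 r q, ← sub_eq_zero, ← D p r 0 0 q]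
    simp only [sub_zero]
    abel
  have D2 : ∀ p q, g₂ p (q + 1) - g₂ p q = g₂ p 1 - g₂ p 0 := by
    intro p q
    rw [D2' p 0 q, ← D2' p 0 0, zero_add]
  have E : ∀ p r, g₂ p 1 - g₂ p 0 = (g₃ (p + r) 1 - g₃ (p + r) 0) - (g₄ r 1 - g₄ r 0) := by
    intro p r
    simpa using D2' p r 0
  have h4 : ∀ r, (g₄ (r + 1) 1 - g₄ (r + 1) 0) - (g₄ r 1 - g₄ r 0) =
      (g₂ 1 1 - g₂ 1 0) - (g₂ 0 1 - g₂ 0 0) := by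
    intro r
    rw [E 1 r, E 0 (r + 1), zero_add, add_comm 1 r]
    abel
  have h3 : ∀ r, (g₃ (r + 1) 1 - g₃ (r + 1) 0) - (g₃ r 1 - g₃ r 0) =
      (g₂ 1 1 - g₂ 1 0) - (g₂ 0 1 - g₂ 0 0) := by
    intro r
    rw [E 1 r, E 0 r, zero_add, add_comm 1 r]
    abel
  have h2 : ∀ p, (g₂ (p + 1) 1 - g₂ (p + 1) 0) - (g₂ p 1 - g₂ p 0) =
      (g₂ 1 1 - g₂ 1 0) - (g₂ 0 1 - g₂ 0 0) := by
    intro p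
    rw [← h3 p, E (p + 1) 0, E p 0, add_zero, add_zero]
    abel
  exact ⟨_, hasDoubleDiff_of_succ D2 h2, hasDoubleDiff_of_succ D3 h3,
    hasDoubleDiff_of_succ D4 h4⟩

lemma two_nsmul_eq_zero_of_hasDoubleDiff {k : A}
    (H : ∀ p₀ p₁ q₀ q₁ q₂ : ℤ, g₀ p₀ q₀ - g₁ p₁ q₁ + g₂ (p₁ - p₀) q₂ -
      g₃ (p₁ - p₀ + q₁ - q₀) (q₂ - q₁) + g₄ (q₁ - q₀) (q₂ - q₁ - p₀) = 0)
    (h₀ : HasDoubleDiff g₀ k) (h₄ : HasDoubleDiff g₄ k) : 2 • k = 0 := by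
  have a := H 1 1 1 0 0
  have b := H 0 0 0 0 0
  have c := H 1 1 0 0 0
  have d := H 0 0 1 0 0
  have e := h₀ 1 1 0 0
  have f := h₄ (-1) (-1) 0 0
  norm_num at a b c d e f
  have hs : 2 • k = (g₀ 1 1 + g₀ 0 0 - g₀ 1 0 - g₀ 0 1) +
      (g₄ (-1) (-1) + g₄ 0 0 - g₄ (-1) 0 - g₄ 0 (-1)) := by
    rw [e, f, two_nsmul]
  have ht := congrArg₂ (· - ·) (congrArg₂ (· + ·) a b) (congrArg₂ (· + ·) c d)
  simp only [add_zero, sub_zero] at ht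
  rw [hs, ← ht]
  abel

end DoubleDifference

lemma HasDoubleDiff.eq_kap {x : ℂ} {k : EPreBloch'} (h : HasDoubleDiff (cls' x) k) :
    k = kap x := by
  simpa [kap] using (h 1 1 0 0).symm

lemma exists_hasDoubleDiff_cls' {x y : ℂ} (h : Admissible x y) :
    ∃ k, HasDoubleDiff (cls' (ftTuple x y 2)) k ∧ HasDoubleDiff (cls' (ftTuple x y 4)) k := by
  obtain ⟨P, Q, H⟩ := exists_five_term h
  obtain ⟨k, h2, -, h4⟩ := exists_hasDoubleDiff
    (g₀ := fun p q => cls' (ftTuple x y 0) (P 0 + p) (Q 0 + q))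
    (g₁ := fun p q => cls' (ftTuple x y 1) (P 1 + p) (Q 1 + q))
    (g₂ := fun p q => cls' (ftTuple x y 2) (P 2 + p) (Q 2 + q))
    (g₃ := fun p q => cls' (ftTuple x y 3) (P 3 + p) (Q 3 + q))
    (g₄ := fun p q => cls' (ftTuple x y 4) (P 4 + p) (Q 4 + q)) H
  exact ⟨k, h2.of_shift, h4.of_shift⟩

lemma exists_hasDoubleDiff_of_mul_ne_one {a b : ℂ} (ha : Reg a) (hb : Reg b) (hab : a * b ≠ 1) :
    ∃ k, HasDoubleDiff (cls' a) k ∧ HasDoubleDiff (cls' b) k := by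
  have ha1 := ha.one_sub_ne_zero
  have hb1 := hb.one_sub_ne_zero
  have hab1 : 1 - a * b ≠ 0 := sub_ne_zero_of_ne (Ne.symm hab)
  have ha0 := ha.1
  have hb0 := hb.1
  have hx : (1 - b) / (1 - a * b) ≠ 0 := div_ne_zero hb1 hab1
  have e1 : 1 - (1 - b) / (1 - a * b) = b * (1 - a) / (1 - a * b) := by
    rw [eq_div_iff hab1, sub_mul, div_mul_cancel₀ _ hab1]
    ring
  have e2 : 1 - a * (1 - b) / (1 - a * b) = (1 - a) / (1 - a * b) := by
    rw [eq_div_iff hab1, sub_mul, div_mul_cancel₀ _ hab1]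
    ring
  have hadm : Admissible ((1 - b) / (1 - a * b)) (a * (1 - b) / (1 - a * b)) := by
    refine ⟨⟨hx, fun h => ?_⟩, ⟨div_ne_zero (mul_ne_zero ha0 hb1) hab1, fun h => ?_⟩, fun h => ?_⟩
    · rw [h, sub_self] at e1
      exact div_ne_zero (mul_ne_zero hb0 ha1) hab1 e1.symm
    · rw [h, sub_self] at e2
      exact div_ne_zero ha1 hab1 e2.symm
    · rw [mul_div_assoc] at h
      exact ha.2 (mul_right_cancel₀ hx (by rw [one_mul]; exact h.symm))
  obtain ⟨k, h2, h4⟩ := exists_hasDoubleDiff_cls' hadm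
  have f2 : ftTuple ((1 - b) / (1 - a * b)) (a * (1 - b) / (1 - a * b)) 2 = a := by
    change a * (1 - b) / (1 - a * b) / ((1 - b) / (1 - a * b)) = a
    field_simp
  have f4 : ftTuple ((1 - b) / (1 - a * b)) (a * (1 - b) / (1 - a * b)) 4 = b := by
    change (1 - (1 - b) / (1 - a * b)) / (1 - a * (1 - b) / (1 - a * b)) = b
    rw [e1, e2, div_div_div_cancel_right₀ hab1, mul_div_cancel_right₀ _ ha1]
  rw [f2] at h2
  rw [f4] at h4
  exact ⟨k, h2, h4⟩

lemma exists_reg_mul_ne_one (a b : ℂ) : ∃ c, Reg c ∧ a * c ≠ 1 ∧ b * c ≠ 1 := by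
  obtain ⟨c, hc⟩ := Infinite.exists_notMem_finset ({0, 1, a⁻¹, b⁻¹} : Finset ℂ)
  simp only [Finset.mem_insert, Finset.mem_singleton, not_or] at hc
  exact ⟨c, ⟨hc.1, hc.2.1⟩, fun h => hc.2.2.1 (eq_inv_of_mul_eq_one_right h),
    fun h => hc.2.2.2 (eq_inv_of_mul_eq_one_right h)⟩

lemma hasDoubleDiff_kap {x : ℂ} (hx : Reg x) : HasDoubleDiff (cls' x) (kap x) := by
  obtain ⟨c, hc, hxc, -⟩ := exists_reg_mul_ne_one x x
  obtain ⟨k, h, -⟩ := exists_hasDoubleDiff_of_mul_ne_one hx hc hxc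
  rwa [← h.eq_kap]

lemma kap_eq_kap {x y : ℂ} (hx : Reg x) (hy : Reg y) : kap x = kap y := by
  obtain ⟨c, hc, hxc, hyc⟩ := exists_reg_mul_ne_one x y
  obtain ⟨k, h1, h2⟩ := exists_hasDoubleDiff_of_mul_ne_one hx hc hxc
  obtain ⟨l, h3, h4⟩ := exists_hasDoubleDiff_of_mul_ne_one hy hc hyc
  rw [← h1.eq_kap, ← h3.eq_kap, h2.eq_kap, h4.eq_kap]

lemma two_nsmul_kap {x : ℂ} (hx : Reg x) : 2 • kap x = 0 := by
  obtain ⟨P, Q, H⟩ := exists_five_term admissible_base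
  refine two_nsmul_eq_zero_of_hasDoubleDiff
    (g₀ := fun p q => cls' (ftTuple ((1 + I) / 4) I 0) (P 0 + p) (Q 0 + q))
    (g₁ := fun p q => cls' (ftTuple ((1 + I) / 4) I 1) (P 1 + p) (Q 1 + q))
    (g₂ := fun p q => cls' (ftTuple ((1 + I) / 4) I 2) (P 2 + p) (Q 2 + q))
    (g₃ := fun p q => cls' (ftTuple ((1 + I) / 4) I 3) (P 3 + p) (Q 3 + q))
    (g₄ := fun p q => cls' (ftTuple ((1 + I) / 4) I 4) (P 4 + p) (Q 4 + q)) H ?_ ?_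
  · rw [kap_eq_kap hx (admissible_base.reg_ftTuple 0)]
    exact (hasDoubleDiff_kap (admissible_base.reg_ftTuple 0)).shift _ _
  · rw [kap_eq_kap hx (admissible_base.reg_ftTuple 4)]
    exact (hasDoubleDiff_kap (admissible_base.reg_ftTuple 4)).shift _ _

/-! ### The parity homomorphism `[z, p, q] ↦ pq mod 2` -/

lemma exp_int_mul_Cpi_I_of_even {n : ℤ} (h : Even n) : Complex.exp (n * (Cpi * I)) = 1 := by
  rw [Complex.exp_int_mul, Cpi, Complex.exp_pi_mul_I, h.neg_one_zpow]

lemma exp_int_mul_Cpi_I_of_odd {n : ℤ} (h : Odd n) : Complex.exp (n * (Cpi * I)) = -1 := by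
  rw [Complex.exp_int_mul, Cpi, Complex.exp_pi_mul_I, h.neg_one_zpow]

lemma exp_pt_fst {z : ℂ} (h : Reg z) (p q : ℤ) :
    Complex.exp (pt z p q).1 = z * Complex.exp (p * (Cpi * I)) := by
  rw [pt, Complex.exp_add, Complex.exp_log h.1]

lemma exp_neg_pt_snd {z : ℂ} (h : Reg z) (p q : ℤ) :
    Complex.exp (-(pt z p q).2) = (1 - z) * Complex.exp ((-q : ℤ) * (Cpi * I)) := by
  have : -(pt z p q).2 = Complex.log (1 - z) + (-q : ℤ) * (Cpi * I) := by
    simp only [pt]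
    push_cast
    ring
  rw [this, Complex.exp_add, Complex.exp_log h.one_sub_ne_zero]

/-- The function on `𝓒` given by `(z; p, q) ↦ pq mod 2`. -/
def parity (w : ℂ × ℂ) : ZMod 2 :=
  if -Complex.exp w.1 - Complex.exp (-w.2) = 1 then 1 else 0

lemma parity_pt {z : ℂ} (h : Reg z) (p q : ℤ) : parity (pt z p q) = (p * q : ℤ) := by
  have h0 := h.1
  have h1 := h.one_sub_ne_zero
  rw [parity, exp_pt_fst h, exp_neg_pt_snd h]
  rcases Int.even_or_odd p with hp | hp <;> rcases Int.even_or_odd q with hq | hq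
  · rw [exp_int_mul_Cpi_I_of_even hp, exp_int_mul_Cpi_I_of_even hq.neg, if_neg,
      ((ZMod.intCast_eq_zero_iff_even).2 (hp.mul_right q))]
    intro h'
    have : (2 : ℂ) = 0 := by linear_combination -h'
    norm_num at this
  · rw [exp_int_mul_Cpi_I_of_even hp, exp_int_mul_Cpi_I_of_odd hq.neg, if_neg,
      ((ZMod.intCast_eq_zero_iff_even).2 (hp.mul_right q))]
    intro h'
    exact h0 (by linear_combination (-1 / 2) * h')
  · rw [exp_int_mul_Cpi_I_of_odd hp, exp_int_mul_Cpi_I_of_even hq.neg, if_neg,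
      ((ZMod.intCast_eq_zero_iff_even).2 (hq.mul_left p))]
    intro h'
    exact h1 (by linear_combination (-1 / 2) * h')
  · rw [exp_int_mul_Cpi_I_of_odd hp, exp_int_mul_Cpi_I_of_odd hq.neg, if_pos (by ring),
      ((ZMod.intCast_eq_one_iff_odd).2 (hp.mul hq))]

lemma even_of_exp_add_exp_eq_one {z : ℂ} (h : Reg z) {p q : ℤ}
    (he : Complex.exp (pt z p q).1 + Complex.exp (-(pt z p q).2) = 1) : Even p ∧ Even q := by
  have h0 := h.1
  have h1 := h.one_sub_ne_zero
  rw [exp_pt_fst h, exp_neg_pt_snd h] at he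
  rcases Int.even_or_odd p with hp | hp <;> rcases Int.even_or_odd q with hq | hq
  · exact ⟨hp, hq⟩
  · rw [exp_int_mul_Cpi_I_of_even hp, exp_int_mul_Cpi_I_of_odd hq.neg] at he
    exact absurd (by linear_combination (-1 / 2) * he) h1
  · rw [exp_int_mul_Cpi_I_of_odd hp, exp_int_mul_Cpi_I_of_even hq.neg] at he
    exact absurd (by linear_combination (-1 / 2) * he) h0
  · rw [exp_int_mul_Cpi_I_of_odd hp, exp_int_mul_Cpi_I_of_odd hq.neg] at he
    have : (2 : ℂ) = 0 := by linear_combination -he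
    norm_num at this

lemma exp_pt_cases {z : ℂ} (h : Reg z) (p q : ℤ) :
    Complex.exp (pt z p q).1 + Complex.exp (-(pt z p q).2) = 1 ∨
    Complex.exp (pt z p q).1 - Complex.exp (-(pt z p q).2) = 1 ∨
    -Complex.exp (pt z p q).1 + Complex.exp (-(pt z p q).2) = 1 ∨
    -Complex.exp (pt z p q).1 - Complex.exp (-(pt z p q).2) = 1 := by
  rw [exp_pt_fst h, exp_neg_pt_snd h]
  rcases Int.even_or_odd p with hp | hp <;> rcases Int.even_or_odd q with hq | hq
  · rw [exp_int_mul_Cpi_I_of_even hp, exp_int_mul_Cpi_I_of_even hq.neg]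
    left; ring
  · rw [exp_int_mul_Cpi_I_of_even hp, exp_int_mul_Cpi_I_of_odd hq.neg]
    right; left; ring
  · rw [exp_int_mul_Cpi_I_of_odd hp, exp_int_mul_Cpi_I_of_even hq.neg]
    right; right; left; ring
  · rw [exp_int_mul_Cpi_I_of_odd hp, exp_int_mul_Cpi_I_of_odd hq.neg]
    right; right; right; ring

lemma exp_add_exp_eq_one_of_mem_FThat₀ {w : Fin 5 → ℂ × ℂ} (hw : w ∈ FThat₀) (i : Fin 5) :
    Complex.exp (w i).1 + Complex.exp (-(w i).2) = 1 := by
  by_contra hne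
  let s : Set (Fin 5 → ℂ × ℂ) := {u | Complex.exp (u i).1 + Complex.exp (-(u i).2) = 1}
  let t : Set (Fin 5 → ℂ × ℂ) := {u | Complex.exp (u i).1 - Complex.exp (-(u i).2) = 1} ∪
    ({u | -Complex.exp (u i).1 + Complex.exp (-(u i).2) = 1} ∪
      {u | -Complex.exp (u i).1 - Complex.exp (-(u i).2) = 1})
  have hs : IsClosed s := isClosed_eq (by fun_prop) (by fun_prop)
  have ht : IsClosed t := (isClosed_eq (by fun_prop) (by fun_prop)).union
    ((isClosed_eq (by fun_prop) (by fun_prop)).union (isClosed_eq (by fun_prop) (by fun_prop)))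
  have hst : FThat₀ ⊆ s ∪ t := by
    intro u hu
    obtain ⟨v, -, hv⟩ := connectedComponentIn_subset _ _ hu
    obtain ⟨hr, p, q, h⟩ := hv i
    have := exp_pt_cases hr p q
    rwa [← h] at this
  have hbase : basePt ∈ s := by
    have hr := admissible_base.reg_ftTuple i
    change Complex.exp (pt _ 0 0).1 + Complex.exp (-(pt _ 0 0).2) = 1
    rw [exp_pt_fst hr, exp_neg_pt_snd hr]
    simp
  obtain ⟨u, -, hus, hut⟩ := isPreconnected_closed_iff.1
    (isPreconnected_connectedComponentIn (F := FTpre) (x := basePt)) s t hs ht hst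
    ⟨basePt, mem_connectedComponentIn basePt_mem_FTpre, hbase⟩
    ⟨w, hw, (hst hw).resolve_left hne⟩
  have hus' : Complex.exp (u i).1 + Complex.exp (-(u i).2) = 1 := hus
  rcases hut with h | h | h
  · have h' : Complex.exp (u i).1 - Complex.exp (-(u i).2) = 1 := h
    exact Complex.exp_ne_zero (-(u i).2) (by linear_combination (hus' - h') / 2)
  · have h' : -Complex.exp (u i).1 + Complex.exp (-(u i).2) = 1 := h
    exact Complex.exp_ne_zero (u i).1 (by linear_combination (hus' - h') / 2)
  · have h' : -Complex.exp (u i).1 - Complex.exp (-(u i).2) = 1 := h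
    have : (2 : ℂ) = 0 := by linear_combination -(hus' + h')
    norm_num at this

lemma parity_covAct {w : Fin 5 → ℂ × ℂ} (hw : w ∈ FThat₀) (v : ℤ × ℤ) (i : Fin 5) :
    parity (covAct v (w i)) = (v.1 * v.2 : ℤ) := by
  obtain ⟨u, -, hu⟩ := connectedComponentIn_subset _ _ hw
  obtain ⟨hr, p, q, h⟩ := hu i
  have he := exp_add_exp_eq_one_of_mem_FThat₀ hw i
  rw [h] at he ⊢
  obtain ⟨hp, hq⟩ := even_of_exp_add_exp_eq_one hr he
  rw [covAct_pt, parity_pt hr]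
  push_cast
  rw [(ZMod.intCast_eq_zero_iff_even).2 hp, (ZMod.intCast_eq_zero_iff_even).2 hq]
  ring

/-- The homomorphism `(z; p, q) ↦ pq mod 2` on the free abelian group on `𝓒`. -/
def parityFree : FreeAbelianGroup CoverT →+ ZMod 2 :=
  FreeAbelianGroup.lift fun w : CoverT => parity w.1

lemma relSub'_le_ker_parityFree : relSub' ≤ parityFree.ker := by
  refine (AddSubgroup.closure_le _).2 ?_
  rintro _ ⟨u, ⟨w, hw, v, ⟨p₀, p₁, q₀, q₁, q₂, rfl⟩, rfl⟩, hc, rfl⟩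
  change parityFree _ = 0
  have h2 : (2 : ZMod 2) = 0 := rfl
  simp [parityFree, parity_covAct hw, Fin.sum_univ_five]
  linear_combination (p₀ * q₀ - p₀ * q₂ + q₀ * q₁ - q₀ * q₂ + p₁ * q₂ + q₁ * q₂ - q₁ ^ 2 : ZMod 2) *
    h2

/-- The homomorphism `[z, p, q] ↦ pq mod 2` on `êP'(ℂ)`. -/
def parityHom : EPreBloch' →+ ZMod 2 :=
  QuotientAddGroup.lift relSub' parityFree fun _ ha => relSub'_le_ker_parityFree ha

lemma parityHom_cls' {z : ℂ} (h : Reg z) (p q : ℤ) : parityHom (cls' z p q) = (p * q : ℤ) := by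
  rw [cls'_eq h]
  change parityFree (genOf z h p q) = _
  rw [parityFree, genOf, FreeAbelianGroup.lift_apply_of, parity_pt h]

lemma parityHom_kap {x : ℂ} (h : Reg x) : parityHom (kap x) = 1 := by
  simp [kap, parityHom_cls' h]

/-! ### The projection to `êP(ℂ)` -/

lemma projP_mk (a : FreeAbelianGroup CoverT) :
    projP (QuotientAddGroup.mk a) = QuotientAddGroup.mk a := rfl

lemma projP_surjective : Function.Surjective projP := by
  intro b
  obtain ⟨a, rfl⟩ := QuotientAddGroup.mk_surjective b
  exact ⟨QuotientAddGroup.mk a, rfl⟩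

lemma projP_kap {x : ℂ} (h : Reg x) : projP (kap x) = 0 := by
  simp only [kap, cls'_eq h, ← QuotientAddGroup.mk_add, ← QuotientAddGroup.mk_sub, projP_mk]
  exact (QuotientAddGroup.eq_zero_iff _).2
    (AddSubgroup.subset_closure (Or.inr ⟨x, h, 1, 1, 0, 0, rfl⟩))

lemma mem_closure_kap_of_projP_eq_zero {x : ℂ} (hx : Reg x) {a : EPreBloch'}
    (ha : projP a = 0) : a ∈ AddSubgroup.closure ({kap x} : Set EPreBloch') := by
  obtain ⟨b, rfl⟩ := QuotientAddGroup.mk_surjective a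
  rw [projP_mk, QuotientAddGroup.eq_zero_iff] at ha
  have hle : relSub ≤ (AddSubgroup.closure ({kap x} : Set EPreBloch')).comap
      (QuotientAddGroup.mk' relSub') := by
    refine (AddSubgroup.closure_le _).2 ?_
    rintro c (hc | ⟨z, hz, p, q, p', q', rfl⟩)
    · have : (QuotientAddGroup.mk c : EPreBloch') = 0 :=
        (QuotientAddGroup.eq_zero_iff _).2 (AddSubgroup.subset_closure hc)
      change (QuotientAddGroup.mk c : EPreBloch') ∈ AddSubgroup.closure {kap x}
      rw [this]
      exact zero_mem _
    · have h := hasDoubleDiff_kap hz p q p' q'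
      rw [kap_eq_kap hz hx] at h
      simp only [cls'_eq hz] at h
      exact AddSubgroup.mem_closure_singleton.2 ⟨_, h.symm⟩
  exact hle ha

lemma coe_wedge (a b : ℂ) :
    (wedge a b : ExteriorAlgebra ℤ ℂ) = ExteriorAlgebra.ι ℤ a * ExteriorAlgebra.ι ℤ b := by
  simp [wedge, ExteriorAlgebra.ιMulti_apply]

lemma wedge_add_left (a b c : ℂ) : wedge (a + b) c = wedge a c + wedge b c := by
  apply Subtype.ext
  simp only [Submodule.coe_add, coe_wedge, map_add, add_mul]

lemma wedge_add_right (a b c : ℂ) : wedge a (b + c) = wedge a b + wedge a c := by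
  apply Subtype.ext
  simp only [Submodule.coe_add, coe_wedge, map_add, mul_add]

lemma wedge_smul_smul (m n : ℤ) (a : ℂ) : wedge (m * a) (n * a) = 0 := by
  apply Subtype.ext
  simp only [coe_wedge, ← zsmul_eq_mul, map_zsmul, smul_mul_smul_comm, ExteriorAlgebra.ι_sq_zero,
    smul_zero, Submodule.coe_zero]

lemma nuFree_genOf {z : ℂ} (h : Reg z) (p q : ℤ) :
    nuFree (genOf z h p q) = wedge (Complex.log z) (-Complex.log (1 - z)) +
      wedge (Complex.log z) (q * (Cpi * I)) + wedge (p * (Cpi * I)) (-Complex.log (1 - z)) := by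
  rw [nuFree, genOf, FreeAbelianGroup.lift_apply_of]
  simp only [pt, wedge_add_left, wedge_add_right, wedge_smul_smul]
  abel

lemma nuFree_of_mem_transferRels {a : FreeAbelianGroup CoverT} (ha : a ∈ TransferRels) :
    nuFree a = 0 := by
  obtain ⟨z, hz, p, q, p', q', rfl⟩ := ha
  simp only [map_sub, map_add, nuFree_genOf]
  abel

lemma nuHom_projP (a : EPreBloch') : nuHom (projP a) = nuHom' a := by
  obtain ⟨b, rfl⟩ := QuotientAddGroup.mk_surjective a
  rw [projP_mk]
  by_cases h : ∀ a ∈ relSub', nuFree a = 0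
  · have h' : ∀ a ∈ relSub, nuFree a = 0 := by
      intro a ha
      refine (AddSubgroup.closure_le nuFree.ker).2 ?_ ha
      rintro c (hc | hc)
      · exact h c (AddSubgroup.subset_closure hc)
      · exact nuFree_of_mem_transferRels hc
    rw [nuHom, nuHom', dif_pos h, dif_pos h']
    rfl
  · have h' : ¬ ∀ a ∈ relSub, nuFree a = 0 := fun h' =>
      h fun a ha => h' a (AddSubgroup.closure_mono Set.subset_union_left ha)
    rw [nuHom, nuHom', dif_neg h, dif_neg h']
    rfl

/-- A homomorphism to `ZMod 2` sending `k` to `1`, where `2 • k = 0`, gives a retraction onto the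
subgroup generated by `k`. -/
lemma exists_retraction {G : Type*} [AddCommGroup G] {k : G} (hk : 2 • k = 0) (f : G →+ ZMod 2)
    (hf : f k = 1) :
    ∃ s : G →+ AddSubgroup.closure ({k} : Set G), ∀ c : AddSubgroup.closure ({k} : Set G),
      s c = c := by
  let k' : AddSubgroup.closure ({k} : Set G) := ⟨k, AddSubgroup.subset_closure rfl⟩
  have hk' : zmultiplesHom _ k' (2 : ℕ) = 0 := by
    apply Subtype.ext
    change ((2 : ℕ) : ℤ) • k = 0
    rw [natCast_zsmul, hk]
  refine ⟨(ZMod.lift 2 ⟨zmultiplesHom _ k', hk'⟩).comp f, ?_⟩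
  rintro ⟨c, hc⟩
  obtain ⟨n, rfl⟩ := AddSubgroup.mem_closure_singleton.1 hc
  apply Subtype.ext
  have h1 : f (n • k) = ((n : ℤ) : ZMod 2) := by simp [hf]
  simp only [AddMonoidHom.comp_apply, h1]
  rw [ZMod.lift_coe]
  simp [k']

lemma bijective_prod_of_retraction {G H : Type*} [AddCommGroup G] [AddCommGroup H] (π : G →+ H)
    (hπ : Function.Surjective π) {C : AddSubgroup G} (hC : ∀ a, π a = 0 ↔ a ∈ C) (s : G →+ C)
    (hs : ∀ c : C, s c = c) : Function.Bijective (π.prod s) := by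
  constructor
  · refine (injective_iff_map_eq_zero _).2 fun a ha => ?_
    obtain ⟨h1, h2⟩ := Prod.mk.inj ha
    have := hs ⟨a, (hC a).1 h1⟩
    rw [show s ((⟨a, (hC a).1 h1⟩ : C) : G) = 0 from h2] at this
    exact (congrArg Subtype.val this).symm
  · rintro ⟨b, c⟩
    obtain ⟨a, rfl⟩ := hπ b
    refine ⟨a + ((c - s a : C) : G), Prod.ext ?_ ?_⟩
    · change π (a + ((c - s a : C) : G)) = π a
      rw [map_add, (hC _).2 (c - s a).2, add_zero]
    · change s (a + ((c - s a : C) : G)) = c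
      rw [map_add, hs]
      abel

/-- A splitting `G ≃ H × C` restricts to preimages of subgroups of `H`. -/
lemma bijective_restrict_prod {G H C : Type*} [AddCommGroup G] [AddCommGroup H] [AddCommGroup C]
    {π : G →+ H} {s : G →+ C} (hb : Function.Bijective (π.prod s)) {G' : AddSubgroup G}
    {H' : AddSubgroup H} (h : ∀ a, a ∈ G' ↔ π a ∈ H') :
    Function.Bijective (((π.comp G'.subtype).codRestrict H' fun a => (h a).1 a.2).prod
      (s.comp G'.subtype)) := by
  constructor
  · intro a b hab
    obtain ⟨h1, h2⟩ := Prod.mk.inj hab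
    exact Subtype.ext (hb.1 (Prod.ext (congrArg Subtype.val h1) h2))
  · rintro ⟨b, c⟩
    obtain ⟨a, ha⟩ := hb.2 ((b : H), c)
    obtain ⟨h1, h2⟩ := Prod.mk.inj ha
    have h1' : π a = b := h1
    exact ⟨⟨a, (h a).2 (h1' ▸ b.2)⟩, Prod.ext (Subtype.ext h1) h2⟩

/-- in `êP'(ℂ)` the element `κ = [x,1,1] + [x,0,0] - [x,1,0] - [x,0,1]` is
independent of `x` and has order exactly 2; moreover `êP'(ℂ) ≅ êP(ℂ) × C₂` and
`êB'(ℂ) ≅ êB(ℂ) × C₂`, where `C₂` is the cyclic subgroup of order 2 generated by `κ`, the first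
factor of the isomorphism being the natural projection `êP'(ℂ) → êP(ℂ)`. -/
theorem stmt13 :
    (∀ x y : ℂ, Reg x → Reg y → kap x = kap y) ∧
    (∀ x : ℂ, Reg x → addOrderOf (kap x) = 2) ∧
    (∀ x : ℂ, Reg x →
      (∃ e : EPreBloch' ≃+ EPreBloch × ↥(AddSubgroup.closure ({kap x} : Set EPreBloch')),
        ∀ a : EPreBloch', (e a).1 = projP a) ∧
      (∃ e : ↥EBloch' ≃+ ↥EBloch × ↥(AddSubgroup.closure ({kap x} : Set EPreBloch')),
        ∀ a : ↥EBloch', ((e a).1 : EPreBloch) = projP (a : EPreBloch'))) := by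
  refine ⟨fun x y => kap_eq_kap, fun x hx => addOrderOf_eq_prime (two_nsmul_kap hx) fun h => ?_,
    fun x hx => ?_⟩
  · have h1 := parityHom_kap hx
    rw [h, map_zero] at h1
    exact zero_ne_one h1
  · obtain ⟨s, hs⟩ := exists_retraction (two_nsmul_kap hx) parityHom (parityHom_kap hx)
    have hC : ∀ a, projP a = 0 ↔ a ∈ AddSubgroup.closure ({kap x} : Set EPreBloch') := by
      refine fun a => ⟨mem_closure_kap_of_projP_eq_zero hx, fun ha => ?_⟩
      obtain ⟨n, rfl⟩ := AddSubgroup.mem_closure_singleton.1 ha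
      rw [map_zsmul, projP_kap hx, smul_zero]
    have hb := bijective_prod_of_retraction projP projP_surjective hC s hs
    have hmem : ∀ a, a ∈ EBloch' ↔ projP a ∈ EBloch := by
      intro a
      rw [EBloch, EBloch', AddMonoidHom.mem_ker, AddMonoidHom.mem_ker, nuHom_projP]
    exact ⟨⟨AddEquiv.ofBijective _ hb, fun _ => rfl⟩,
      ⟨AddEquiv.ofBijective _ (bijective_restrict_prod hb hmem), fun _ => rfl⟩⟩

end ExtendedBloch

end
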